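/- arXiv:1209.4795 — 2 statements merged into one kernel-verified Lean document; each statement's English description precedes it below -/
import Mathlib

section
/- (The classical Kirkman point) Let A, B, C, D, E, F be six distinct points of ℙ²(ℂ) on an irreducible conic, no three of them collinear. Assume the Pascal lines of the hexagons ABFDCE, AEFBDC and ABDFEC are all defined, i.e. each of the three pairs of reducible cubics (l(AB)·l(FD)·l(CE), l(BF)·l(DC)·l(EA)), (l(AE)·l(FB)·l(DC), l(EF)·l(BD)·l(CA)) and (l(AB)·l(DF)·l(EC), l(BD)·l(FE)·l(CA)) satisfies the hypotheses for a generalized Pascal line. Then these three Pascal lines pass through a common point. -/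
open MvPolynomial

noncomputable section

/-- Polynomials in three variables over `ℂ`. -/
abbrev Poly3 : Type := MvPolynomial (Fin 3) ℂ

/-- The complex projective plane `ℙ²(ℂ)`, the projectivization of `ℂ³`. -/
abbrev ProjPlane : Type := Projectivization ℂ (Fin 3 → ℂ)

/-- A (homogeneous) polynomial vanishes at a projective point if it vanishes at its
canonical nonzero representative vector (for homogeneous polynomials this is equivalent
to vanishing at any nonzero representative vector). -/
def VanishesAt (F : Poly3) (p : ProjPlane) : Prop :=
  MvPolynomial.eval p.rep F = 0

/-- The set of points of `ℙ²(ℂ)` at which `F` vanishes. -/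
def zeroSet (F : Poly3) : Set ProjPlane := {p | VanishesAt F p}

/-- Two defining polynomials give the same curve iff they are proportional by a
nonzero scalar. -/
def ProportionalTo (F G : Poly3) : Prop := ∃ c : ℂ, c ≠ 0 ∧ G = c • F

/-- A set of points is collinear if some nonzero homogeneous polynomial of degree 1
vanishes at all of them. -/
def Collin (s : Set ProjPlane) : Prop :=
  ∃ L : Poly3, L ≠ 0 ∧ L.IsHomogeneous 1 ∧ ∀ p ∈ s, VanishesAt L p

/-- No three distinct points of `s` are collinear. -/
def NoThreeCollinear (s : Set ProjPlane) : Prop :=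
  ∀ p q r, p ∈ s → q ∈ s → r ∈ s → p ≠ q → p ≠ r → q ≠ r → ¬ Collin {p, q, r}

/-- `L` is a (the) line through the points `p` and `q`. -/
def IsLineThrough (L : Poly3) (p q : ProjPlane) : Prop :=
  L ≠ 0 ∧ L.IsHomogeneous 1 ∧ VanishesAt L p ∧ VanishesAt L q

/-- `L` is the generalized Pascal line of the cubics `D₁` and `D₂` with respect to six
points `A, …, F`: the cubics have no common nonconstant factor, their common zero set
consists of exactly nine distinct points (the six given ones plus three further points),
and `L` is the line through the three further intersection points. -/
def IsGenPascalLine (A B C D E F : ProjPlane) (D₁ D₂ L : Poly3) : Prop :=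
  IsRelPrime D₁ D₂ ∧ L ≠ 0 ∧ L.IsHomogeneous 1 ∧
    ∃ P Q R : ProjPlane,
      ([A, B, C, D, E, F, P, Q, R] : List ProjPlane).Pairwise (· ≠ ·) ∧
      zeroSet D₁ ∩ zeroSet D₂ = {A, B, C, D, E, F, P, Q, R} ∧
      VanishesAt L P ∧ VanishesAt L Q ∧ VanishesAt L R


/-- The exponents of a monomial occurring in a homogeneous polynomial add up to its degree. -/
lemma exponents_add_eq {L : Poly3} {n : ℕ} (hL : L.IsHomogeneous n) {d : Fin 3 →₀ ℕ}
    (hd : d ∈ L.support) : d 0 + d 1 + d 2 = n := by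
  have h : d.degree = n := by
    by_contra h
    exact (mem_support_iff.1 hd) (hL.coeff_eq_zero h)
  rwa [Finsupp.degree_eq_sum, Fin.sum_univ_three] at h

/-- A homogeneous polynomial of degree one evaluates linearly. -/
lemma eval_linear {L : Poly3} (hL : L.IsHomogeneous 1) (x y : ℂ) (a b : Fin 3 → ℂ) :
    eval (x • a + y • b) L = x * eval a L + y * eval b L := by
  simp only [eval_eq', Finset.mul_sum]
  rw [← Finset.sum_add_distrib]
  refine Finset.sum_congr rfl fun d hd => ?_
  have h := exponents_add_eq hL hd
  simp only [Fin.prod_univ_three, Pi.add_apply, Pi.smul_apply, smul_eq_mul]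
  generalize d 0 = i at *
  generalize d 1 = j at *
  generalize d 2 = k at *
  obtain ⟨rfl, rfl, rfl⟩ | ⟨rfl, rfl, rfl⟩ | ⟨rfl, rfl, rfl⟩ :
    (i = 1 ∧ j = 0 ∧ k = 0) ∨ (i = 0 ∧ j = 1 ∧ k = 0) ∨ (i = 0 ∧ j = 0 ∧ k = 1) := by omega
  all_goals ring

/-- The value of a homogeneous polynomial of degree two at a linear combination of three vectors
at which it vanishes. -/
lemma eval_quadratic {K : Poly3} (hK : K.IsHomogeneous 2) {a b c : Fin 3 → ℂ}
    (ha : eval a K = 0) (hb : eval b K = 0) (hc : eval c K = 0) (x y z : ℂ) :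
    eval (x • a + y • b + z • c) K =
      eval (b + c) K * (y * z) + eval (a + c) K * (x * z) + eval (a + b) K * (x * y) := by
  suffices h : eval (x • a + y • b + z • c) K =
      x ^ 2 * eval a K + y ^ 2 * eval b K + z ^ 2 * eval c K
      + y * z * (eval (b + c) K + (-1) * eval b K + (-1) * eval c K)
      + x * z * (eval (a + c) K + (-1) * eval a K + (-1) * eval c K)
      + x * y * (eval (a + b) K + (-1) * eval a K + (-1) * eval b K) by
    rw [h, ha, hb, hc]
    ring
  simp only [eval_eq', Finset.mul_sum, ← Finset.sum_add_distrib]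
  refine Finset.sum_congr rfl fun d hd => ?_
  have h := exponents_add_eq hK hd
  simp only [Fin.prod_univ_three, Pi.add_apply, Pi.smul_apply, smul_eq_mul]
  generalize d 0 = i at *
  generalize d 1 = j at *
  generalize d 2 = k at *
  obtain ⟨rfl, rfl, rfl⟩ | ⟨rfl, rfl, rfl⟩ | ⟨rfl, rfl, rfl⟩ |
      ⟨rfl, rfl, rfl⟩ | ⟨rfl, rfl, rfl⟩ | ⟨rfl, rfl, rfl⟩ :
    (i = 2 ∧ j = 0 ∧ k = 0) ∨ (i = 0 ∧ j = 2 ∧ k = 0) ∨ (i = 0 ∧ j = 0 ∧ k = 2) ∨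
    (i = 1 ∧ j = 1 ∧ k = 0) ∨ (i = 1 ∧ j = 0 ∧ k = 1) ∨ (i = 0 ∧ j = 1 ∧ k = 1) := by omega
  all_goals ring

/-- The linear functional defined by a homogeneous polynomial of degree one. -/
def linearFunctional (L : Poly3) (hL : L.IsHomogeneous 1) : (Fin 3 → ℂ) →ₗ[ℂ] ℂ where
  toFun v := eval v L
  map_add' a b := by simpa using eval_linear hL 1 1 a b
  map_smul' x a := by simpa using eval_linear hL x 0 a 0

@[simp]
lemma linearFunctional_apply (L : Poly3) (hL : L.IsHomogeneous 1) (v : Fin 3 → ℂ) :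
    linearFunctional L hL v = eval v L := rfl

lemma linearFunctional_ne_zero {L : Poly3} (hL : L.IsHomogeneous 1) (h0 : L ≠ 0) :
    linearFunctional L hL ≠ 0 := by
  intro h
  refine h0 (MvPolynomial.funext fun v => ?_)
  simpa using LinearMap.congr_fun h v

/-- Every linear functional comes from a homogeneous polynomial of degree one. -/
lemma exists_isHomogeneous_one (f : (Fin 3 → ℂ) →ₗ[ℂ] ℂ) :
    ∃ L : Poly3, L.IsHomogeneous 1 ∧ ∀ v, eval v L = f v := by
  refine ⟨∑ i, C (f (Pi.single i 1)) * X i,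
    IsHomogeneous.sum _ _ _ fun i _ => isHomogeneous_C_mul_X _ _, fun v => ?_⟩
  simp only [map_sum, map_mul, eval_C, eval_X]
  conv_rhs => rw [LinearMap.pi_apply_eq_sum_univ f v]
  refine Finset.sum_congr rfl fun i _ => ?_
  rw [smul_eq_mul, mul_comm]
  congr 2
  ext j
  simp [Pi.single_apply, eq_comm]

/-- A linear functional vanishing at three noncollinear points is zero. -/
lemma functional_eq_zero_of_not_collin {p q r : ProjPlane} (h : ¬ Collin {p, q, r})
    (f : (Fin 3 → ℂ) →ₗ[ℂ] ℂ) (hp : f p.rep = 0) (hq : f q.rep = 0) (hr : f r.rep = 0) :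
    f = 0 := by
  by_contra hf
  obtain ⟨L, hL, hLf⟩ := exists_isHomogeneous_one f
  refine h ⟨L, ?_, hL, ?_⟩
  · rintro rfl
    exact hf (LinearMap.ext fun v => by simp [← hLf])
  · rintro s (rfl | rfl | rfl) <;> simpa [VanishesAt, hLf]

lemma linearIndependent_of_not_collin {p q r : ProjPlane} (h : ¬ Collin {p, q, r}) :
    LinearIndependent ℂ ![p.rep, q.rep, r.rep] := by
  refine linearIndependent_of_top_le_span_of_card_eq_finrank ?_ (by simp)
  by_contra hn
  obtain ⟨f, hf, hf'⟩ := Submodule.exists_dual_map_eq_bot_of_lt_top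
    (lt_top_iff_ne_top.2 fun e => hn e.ge) inferInstance
  have hz : ∀ i, f (![p.rep, q.rep, r.rep] i) = 0 := fun i => by
    have := Submodule.mem_map_of_mem (f := f) (Submodule.subset_span
      (Set.mem_range_self (f := ![p.rep, q.rep, r.rep]) i))
    rwa [hf', Submodule.mem_bot] at this
  exact hf (functional_eq_zero_of_not_collin h f (hz 0) (hz 1) (hz 2))

lemma linearIndependent_rep {p q : ProjPlane} (h : p ≠ q) :
    LinearIndependent ℂ ![p.rep, q.rep] := by
  have := (Projectivization.independent_iff).1 ((Projectivization.independent_pair_iff_ne p q).2 h)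
  convert! this using 1
  ext i
  fin_cases i <;> rfl

/-- Two linear functionals on `ℂ³` vanishing at two distinct points are proportional. -/
lemma exists_eq_smul_of_vanish {p q : ProjPlane} (h : p ≠ q) {f g : (Fin 3 → ℂ) →ₗ[ℂ] ℂ}
    (hg : g ≠ 0) (hfp : f p.rep = 0) (hfq : f q.rep = 0) (hgp : g p.rep = 0) (hgq : g q.rep = 0) :
    ∃ c : ℂ, f = c • g := by
  have hrank : Module.finrank ℂ (LinearMap.ker g) = 2 := by
    have := Module.Dual.finrank_ker_add_one_of_ne_zero hg
    simpa using this
  have hspan : Submodule.span ℂ (Set.range ![p.rep, q.rep]) = LinearMap.ker g := by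
    refine Submodule.eq_of_le_of_finrank_eq ?_ ?_
    · rw [Submodule.span_le]
      rintro _ ⟨i, rfl⟩
      fin_cases i <;> simpa
    · rw [hrank, finrank_span_eq_card (linearIndependent_rep h)]
      simp
  have hle : LinearMap.ker g ≤ LinearMap.ker f := by
    rw [← hspan, Submodule.span_le]
    rintro _ ⟨i, rfl⟩
    fin_cases i <;> simpa
  have := mem_span_of_iInf_ker_le_ker (L := fun _ : Unit => g) (K := f) (by simpa using hle)
  rw [Set.range_const, Submodule.mem_span_singleton] at this
  obtain ⟨c, hc⟩ := this
  exact ⟨c, hc.symm⟩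

/-- Coordinate functionals with respect to three noncollinear points. -/
lemma exists_coordinates {a b c : ProjPlane} (h : ¬ Collin {a, b, c}) :
    ∃ x y z : (Fin 3 → ℂ) →ₗ[ℂ] ℂ,
      (∀ v, v = x v • a.rep + y v • b.rep + z v • c.rep) ∧
      x a.rep = 1 ∧ x b.rep = 0 ∧ x c.rep = 0 := by
  let e := basisOfLinearIndependentOfCardEqFinrank (linearIndependent_of_not_collin h) (by simp)
  have he0 : e 0 = a.rep := by simp [e]
  have he1 : e 1 = b.rep := by simp [e]
  have he2 : e 2 = c.rep := by simp [e]
  refine ⟨e.coord 0, e.coord 1, e.coord 2, fun v => ?_, ?_, ?_, ?_⟩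
  · conv_lhs => rw [← e.sum_repr v, Fin.sum_univ_three, he0, he1, he2]
    rfl
  · rw [← he0]; simp
  · rw [← he1]; simp
  · rw [← he2]; simp

/-- A nonzero conic through six points, three of which lie neither on a common line nor on the
line `BC`, has nonzero polar form at `B` and `C`. -/
lemma eval_add_ne_zero {K : Poly3} (hK : K.IsHomogeneous 2) (hK0 : K ≠ 0)
    {A B C D E F : ProjPlane}
    (hA : VanishesAt K A) (hB : VanishesAt K B) (hC : VanishesAt K C)
    (hD : VanishesAt K D) (hE : VanishesAt K E) (hF : VanishesAt K F)
    (hABC : ¬ Collin {A, B, C}) (hBCD : ¬ Collin {B, C, D}) (hBCE : ¬ Collin {B, C, E})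
    (hBCF : ¬ Collin {B, C, F}) (hDEF : ¬ Collin {D, E, F}) :
    eval (B.rep + C.rep) K ≠ 0 := by
  intro h
  obtain ⟨x, y, z, hv, hxA, hxB, hxC⟩ := exists_coordinates hABC
  have hx0 : x ≠ 0 := by
    rintro rfl
    simp at hxA
  have hxD : x D.rep ≠ 0 := fun h => hx0 (functional_eq_zero_of_not_collin hBCD x hxB hxC h)
  have hxE : x E.rep ≠ 0 := fun h => hx0 (functional_eq_zero_of_not_collin hBCE x hxB hxC h)
  have hxF : x F.rep ≠ 0 := fun h => hx0 (functional_eq_zero_of_not_collin hBCF x hxB hxC h)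
  set g : (Fin 3 → ℂ) →ₗ[ℂ] ℂ := eval (A.rep + C.rep) K • z + eval (A.rep + B.rep) K • y with hg
  have hKg : ∀ v, eval v K = x v * g v := by
    intro v
    conv_lhs => rw [hv v]
    rw [eval_quadratic hK hA hB hC, h, hg]
    simp only [LinearMap.add_apply, LinearMap.smul_apply, smul_eq_mul]
    ring
  have hg0 : g = 0 := by
    refine functional_eq_zero_of_not_collin hDEF g ?_ ?_ ?_
    · exact (mul_eq_zero.1 ((hKg _).symm.trans hD)).resolve_left hxD
    · exact (mul_eq_zero.1 ((hKg _).symm.trans hE)).resolve_left hxE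
    · exact (mul_eq_zero.1 ((hKg _).symm.trans hF)).resolve_left hxF
  refine hK0 (MvPolynomial.funext fun v => ?_)
  simp [hKg, hg0]

/-- Coordinates in which the zero locus of `K` is the conic `XZ = Y²`. -/
structure ConicCoordinates (K : Poly3) where
  /-- The first coordinate. -/
  X : (Fin 3 → ℂ) →ₗ[ℂ] ℂ
  /-- The second coordinate. -/
  Y : (Fin 3 → ℂ) →ₗ[ℂ] ℂ
  /-- The third coordinate. -/
  Z : (Fin 3 → ℂ) →ₗ[ℂ] ℂ
  eq_zero : ∀ v, X v = 0 → Y v = 0 → Z v = 0 → v = 0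
  mul_eq_sq : ∀ v, eval v K = 0 → X v * Z v = Y v ^ 2

lemma exists_conicCoordinates {K : Poly3} (hK : K.IsHomogeneous 2) {A B C : ProjPlane}
    (hA : VanishesAt K A) (hB : VanishesAt K B) (hC : VanishesAt K C)
    (hABC : ¬ Collin {A, B, C}) (hα : eval (B.rep + C.rep) K ≠ 0)
    (hβ : eval (A.rep + C.rep) K ≠ 0) (hγ : eval (A.rep + B.rep) K ≠ 0) :
    Nonempty (ConicCoordinates K) := by
  obtain ⟨x, y, z, hv, -⟩ := exists_coordinates hABC
  set α := eval (B.rep + C.rep) K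
  set β := eval (A.rep + C.rep) K
  set γ := eval (A.rep + B.rep) K
  refine ⟨⟨-(β⁻¹ • y) - γ⁻¹ • z, γ⁻¹ • z, -(α⁻¹ • x) - γ⁻¹ • z, fun v h1 h2 h3 => ?_,
    fun v h => ?_⟩⟩
  · simp only [LinearMap.sub_apply, LinearMap.neg_apply, LinearMap.smul_apply, smul_eq_mul]
      at h1 h2 h3
    rw [h2, sub_zero, neg_eq_zero] at h1 h3
    have hx : x v = 0 := (mul_eq_zero.1 h3).resolve_left (inv_ne_zero hα)
    have hy : y v = 0 := (mul_eq_zero.1 h1).resolve_left (inv_ne_zero hβ)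
    have hz : z v = 0 := (mul_eq_zero.1 h2).resolve_left (inv_ne_zero hγ)
    rw [hv v, hx, hy, hz]
    simp
  · rw [hv v, eval_quadratic hK hA hB hC] at h
    simp only [LinearMap.sub_apply, LinearMap.neg_apply, LinearMap.smul_apply, smul_eq_mul]
    field_simp
    linear_combination γ * h

namespace ConicCoordinates

variable {K : Poly3} (T : ConicCoordinates K)

/-- The pair `a` is a Veronese parameter of the point `p`. -/
def IsParam (a : ℂ × ℂ) (p : ProjPlane) : Prop :=
  T.X p.rep = a.1 ^ 2 ∧ T.Y p.rep = a.1 * a.2 ∧ T.Z p.rep = a.2 ^ 2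

lemma exists_isParam {p : ProjPlane} (h : T.X p.rep * T.Z p.rep = T.Y p.rep ^ 2) :
    ∃ a, T.IsParam a p := by
  obtain ⟨s, hs⟩ := IsAlgClosed.exists_pow_nat_eq (T.X p.rep) two_pos
  obtain ⟨t, ht⟩ := IsAlgClosed.exists_pow_nat_eq (T.Z p.rep) two_pos
  have hst : T.Y p.rep ^ 2 = (s * t) ^ 2 := by rw [← h, ← hs, ← ht]; ring
  rcases sq_eq_sq_iff_eq_or_eq_neg.1 hst with h | h
  · exact ⟨(s, t), hs.symm, h, ht.symm⟩
  · exact ⟨(s, -t), hs.symm, by rw [h]; ring, by rw [← ht]; ring⟩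

/-- The determinant of two parameters. -/
def det (a b : ℂ × ℂ) : ℂ := a.1 * b.2 - a.2 * b.1

variable {T}

lemma IsParam.ne_zero {a : ℂ × ℂ} {p : ProjPlane} (ha : T.IsParam a p) : a ≠ 0 := by
  rintro rfl
  obtain ⟨h1, h2, h3⟩ := ha
  exact p.rep_nonzero (T.eq_zero _ (by simpa using h1) (by simpa using h2) (by simpa using h3))

lemma IsParam.det_ne_zero {a b : ℂ × ℂ} {p q : ProjPlane} (ha : T.IsParam a p)
    (hb : T.IsParam b q) (hpq : p ≠ q) : det a b ≠ 0 := by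
  intro h
  obtain ⟨c, hc1, hc2⟩ : ∃ c, b.1 = c * a.1 ∧ b.2 = c * a.2 := by
    unfold det at h
    by_cases h1 : a.1 = 0
    · have h2 : a.2 ≠ 0 := fun h2 => ha.ne_zero (Prod.ext h1 h2)
      refine ⟨b.2 / a.2, ?_, by field_simp⟩
      field_simp
      linear_combination -h
    · refine ⟨b.1 / a.1, by field_simp, ?_⟩
      field_simp
      linear_combination h
  have hv : q.rep - c ^ 2 • p.rep = 0 := by
    obtain ⟨h1, h2, h3⟩ := ha
    obtain ⟨h1', h2', h3'⟩ := hb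
    apply T.eq_zero <;> simp only [map_sub, map_smul, smul_eq_mul, h1, h2, h3, h1', h2', h3',
      hc1, hc2] <;> ring
  refine hpq ?_
  rw [← p.mk_rep, ← q.mk_rep, eq_comm, Projectivization.mk_eq_mk_iff']
  exact ⟨c ^ 2, (sub_eq_zero.1 hv).symm⟩

variable (T)

/-- The linear functional of the chord through the points with parameters `a` and `b`. -/
def chord (a b : ℂ × ℂ) : (Fin 3 → ℂ) →ₗ[ℂ] ℂ :=
  (a.2 * b.2) • T.X - (a.1 * b.2 + a.2 * b.1) • T.Y + (a.1 * b.1) • T.Z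

lemma chord_apply (a b : ℂ × ℂ) (v : Fin 3 → ℂ) :
    T.chord a b v = a.2 * b.2 * T.X v - (a.1 * b.2 + a.2 * b.1) * T.Y v + a.1 * b.1 * T.Z v := rfl

lemma chord_comm (a b : ℂ × ℂ) : T.chord a b = T.chord b a := by
  refine LinearMap.ext fun v => ?_
  rw [chord_apply, chord_apply]
  ring

variable {T}

lemma IsParam.chord_eq {c : ℂ × ℂ} {r : ProjPlane} (hc : T.IsParam c r) (a b : ℂ × ℂ) :
    T.chord a b r.rep = det a c * det b c := by
  obtain ⟨h1, h2, h3⟩ := hc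
  rw [chord_apply, h1, h2, h3]
  unfold det
  ring

/-- The line through two points of the conic is their chord. -/
lemma exists_chord_eq {L : Poly3} {p q r : ProjPlane} {a b c : ℂ × ℂ} (hL : IsLineThrough L p q)
    (ha : T.IsParam a p) (hb : T.IsParam b q) (hc : T.IsParam c r)
    (hpq : p ≠ q) (hpr : p ≠ r) (hqr : q ≠ r) :
    ∃ k : ℂ, k ≠ 0 ∧ ∀ v, T.chord a b v = k * eval v L := by
  obtain ⟨hL0, hL1, hLp, hLq⟩ := hL
  obtain ⟨k, hk⟩ := exists_eq_smul_of_vanish hpq (linearFunctional_ne_zero hL1 hL0)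
    (f := T.chord a b) (by rw [ha.chord_eq]; simp [det, mul_comm])
    (by rw [hb.chord_eq]; simp [det, mul_comm]) hLp hLq
  refine ⟨k, ?_, fun v => by rw [hk]; rfl⟩
  rintro rfl
  have h : T.chord a b r.rep = 0 := by rw [hk]; simp
  rw [hc.chord_eq] at h
  exact mul_ne_zero (ha.det_ne_zero hc hpr) (hb.det_ne_zero hc hqr) h

/-- A line through two points of the conic contains no third point of the conic. -/
lemma mul_ne_sq_of_mem_line {L : Poly3} {p q r : ProjPlane} {a b : ℂ × ℂ}
    (ha : T.IsParam a p) (hb : T.IsParam b q) {k : ℂ} (hk : ∀ v, T.chord a b v = k * eval v L)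
    (hpr : p ≠ r) (hqr : q ≠ r) (hr : eval r.rep L = 0) :
    T.X r.rep * T.Z r.rep - T.Y r.rep ^ 2 ≠ 0 := by
  intro h
  obtain ⟨c, hc⟩ := T.exists_isParam (sub_eq_zero.1 h)
  have h := hk r.rep
  rw [hr, mul_zero, hc.chord_eq] at h
  exact mul_ne_zero (ha.det_ne_zero hc hpr) (hb.det_ne_zero hc hqr) h

variable (T)

/-- The quotient by `XZ - Y²` of a product of three chords, up to a remainder depending only on
the set of six endpoints. -/
def chordQuotient (a b c d e f : ℂ × ℂ) : (Fin 3 → ℂ) →ₗ[ℂ] ℂ :=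
  (a.2 * b.2 * (c.2 * d.2) * (e.1 * f.1) + a.2 * b.2 * (c.1 * d.1) * (e.2 * f.2)
    + a.1 * b.1 * (c.2 * d.2) * (e.2 * f.2)) • T.X
  + ((a.1 * b.2 + a.2 * b.1) * (c.1 * d.2 + c.2 * d.1) * (e.1 * f.2 + e.2 * f.1)) • T.Y
  + (a.2 * b.2 * (c.1 * d.1) * (e.1 * f.1) + a.1 * b.1 * (c.2 * d.2) * (e.1 * f.1)
    + a.1 * b.1 * (c.1 * d.1) * (e.2 * f.2)) • T.Z

/-- Pascal's theorem: the cubics formed by alternate sides of an inscribed hexagon differ by the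
product of the conic with a line. -/
lemma chord_mul_sub (a b c d e f : ℂ × ℂ) (v : Fin 3 → ℂ) :
    T.chord a b v * T.chord c d v * T.chord e f v
      - T.chord b c v * T.chord d e v * T.chord f a v =
    (T.X v * T.Z v - T.Y v ^ 2) *
      (T.chordQuotient a b c d e f v - T.chordQuotient b c d e f a v) := by
  simp only [chord_apply, chordQuotient, LinearMap.add_apply, LinearMap.smul_apply, smul_eq_mul]
  ring

end ConicCoordinates

/-- If two cubics differ, up to scalars, by the product of a line `g` with a function not vanishing
at the further intersection points, then the generalized Pascal line is `g`. -/
lemma IsGenPascalLine.eval_eq_zero {A B C D E F : ProjPlane} {D₁ D₂ p : Poly3}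
    (hp : IsGenPascalLine A B C D E F D₁ D₂ p) {k₁ k₂ : ℂ} (hk₁ : k₁ ≠ 0)
    {q : (Fin 3 → ℂ) → ℂ} {g : (Fin 3 → ℂ) →ₗ[ℂ] ℂ}
    (h : ∀ v, k₁ * eval v D₁ - k₂ * eval v D₂ = q v * g v)
    (hq : ∀ P : ProjPlane, A ≠ P → B ≠ P → C ≠ P → D ≠ P → E ≠ P → F ≠ P →
      eval P.rep D₁ = 0 → q P.rep ≠ 0) {v : Fin 3 → ℂ} (hv : g v = 0) :
    eval v p = 0 := by
  obtain ⟨hrel, hp0, hp1, P, Q, R, hne, hZ, hpP, hpQ, -⟩ := hp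
  simp only [List.pairwise_cons, List.mem_cons, List.not_mem_nil, or_false, forall_eq_or_imp,
    forall_eq] at hne
  have hmem : ∀ S, S ∈ ({A, B, C, D, E, F, P, Q, R} : Set ProjPlane) →
      eval S.rep D₁ = 0 ∧ eval S.rep D₂ = 0 := by
    intro S hS
    rw [← hZ] at hS
    exact hS
  have hzero : ∀ S, S ∈ ({A, B, C, D, E, F, P, Q, R} : Set ProjPlane) → q S.rep ≠ 0 →
      g S.rep = 0 := by
    intro S hS hqS
    have := h S.rep
    rw [(hmem S hS).1, (hmem S hS).2, mul_zero, mul_zero, sub_zero, eq_comm, mul_eq_zero] at this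
    exact this.resolve_left hqS
  have hgP : g P.rep = 0 := hzero P (by simp) (hq P (by tauto) (by tauto) (by tauto)
    (by tauto) (by tauto) (by tauto) (hmem P (by simp)).1)
  have hgQ : g Q.rep = 0 := hzero Q (by simp) (hq Q (by tauto) (by tauto) (by tauto)
    (by tauto) (by tauto) (by tauto) (hmem Q (by simp)).1)
  have hg : g ≠ 0 := by
    rintro rfl
    have hD : D₁ = MvPolynomial.C (k₂ / k₁) * D₂ := by
      refine MvPolynomial.funext fun v => ?_
      have := h v
      simp only [LinearMap.zero_apply, mul_zero] at this
      simp only [map_mul, eval_C]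
      field_simp
      linear_combination this
    have hu : IsUnit D₂ := hrel (hD ▸ dvd_mul_left _ _) dvd_rfl
    exact (hu.map (eval A.rep)).ne_zero (hmem A (by simp)).2
  obtain ⟨k, hk⟩ := exists_eq_smul_of_vanish (f := linearFunctional p hp1) (by tauto : P ≠ Q) hg
    hpP hpQ hgP hgQ
  have := LinearMap.congr_fun hk v
  simpa [hv] using this

/-- Two linear functionals on `ℂ³` have a common zero in the projective plane. -/
lemma exists_common_zero (f g : (Fin 3 → ℂ) →ₗ[ℂ] ℂ) :
    ∃ P : ProjPlane, f P.rep = 0 ∧ g P.rep = 0 := by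
  have hlt : Module.finrank ℂ (ℂ × ℂ) < Module.finrank ℂ (Fin 3 → ℂ) := by simp
  obtain ⟨v, hv, hv0⟩ := (Submodule.ne_bot_iff _).1
    (LinearMap.ker_ne_bot_of_finrank_lt (f := f.prod g) hlt)
  obtain ⟨hf, hg⟩ : f v = 0 ∧ g v = 0 := by simpa using hv
  obtain ⟨a, ha⟩ := Projectivization.exists_smul_eq_mk_rep ℂ v hv0
  refine ⟨Projectivization.mk ℂ v hv0, ?_, ?_⟩ <;> rw [← ha, Units.smul_def, map_smul]
  · simp [hf]
  · simp [hg]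

/-- **The classical Kirkman point.** The Pascal lines of the hexagons `ABFDCE`, `AEFBDC`
and `ABDFEC` inscribed in an irreducible conic pass through a common point. -/
theorem classical_kirkman_point (A B C D E F : ProjPlane)
    (hdist : ([A, B, C, D, E, F] : List ProjPlane).Pairwise (· ≠ ·))
    (K : Poly3) (hKh : K.IsHomogeneous 2) (hKirr : Irreducible K)
    (honK : ∀ p ∈ [A, B, C, D, E, F], VanishesAt K p)
    (hn3 : NoThreeCollinear {A, B, C, D, E, F})
    (lAB lBF lDF lCD lCE lAE lEF lBD lAC : Poly3)
    (hlAB : IsLineThrough lAB A B) (hlBF : IsLineThrough lBF B F)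
    (hlDF : IsLineThrough lDF D F) (hlCD : IsLineThrough lCD C D)
    (hlCE : IsLineThrough lCE C E) (hlAE : IsLineThrough lAE A E)
    (hlEF : IsLineThrough lEF E F) (hlBD : IsLineThrough lBD B D)
    (hlAC : IsLineThrough lAC A C)
    (p₁ p₂ p₃ : Poly3)
    (hp₁ : IsGenPascalLine A B C D E F (lAB * lDF * lCE) (lBF * lCD * lAE) p₁)
    (hp₂ : IsGenPascalLine A B C D E F (lAE * lBF * lCD) (lEF * lBD * lAC) p₂)
    (hp₃ : IsGenPascalLine A B C D E F (lAB * lDF * lCE) (lBD * lEF * lAC) p₃) :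
    ∃ X : ProjPlane, VanishesAt p₁ X ∧ VanishesAt p₂ X ∧ VanishesAt p₃ X := by
  have hK0 : K ≠ 0 := hKirr.ne_zero
  simp only [List.pairwise_cons, List.mem_cons, List.not_mem_nil, or_false, forall_eq_or_imp,
    forall_eq] at hdist honK
  obtain ⟨⟨hAB, hAC, hAD, hAE, hAF⟩, ⟨hBC, hBD, hBE, hBF⟩, ⟨hCD, hCE, hCF⟩, ⟨hDE, hDF⟩, hEF, -⟩ :=
    hdist
  obtain ⟨hA, hB, hC, hD, hE, hF⟩ := honK
  have hcol : ∀ p q r, p ∈ ({A, B, C, D, E, F} : Set ProjPlane) →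
      q ∈ ({A, B, C, D, E, F} : Set ProjPlane) → r ∈ ({A, B, C, D, E, F} : Set ProjPlane) →
      p ≠ q → p ≠ r → q ≠ r → ¬ Collin {p, q, r} := hn3
  have hABC : ¬ Collin {A, B, C} := hcol _ _ _ (by simp) (by simp) (by simp) hAB hAC hBC
  have hDEF : ¬ Collin {D, E, F} := hcol _ _ _ (by simp) (by simp) (by simp) hDE hDF hEF
  obtain ⟨T⟩ := exists_conicCoordinates hKh hA hB hC hABC
    (eval_add_ne_zero hKh hK0 hA hB hC hD hE hF hABC
      (hcol _ _ _ (by simp) (by simp) (by simp) hBC hBD hCD)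
      (hcol _ _ _ (by simp) (by simp) (by simp) hBC hBE hCE)
      (hcol _ _ _ (by simp) (by simp) (by simp) hBC hBF hCF) hDEF)
    (eval_add_ne_zero hKh hK0 hB hA hC hD hE hF
      (hcol _ _ _ (by simp) (by simp) (by simp) hAB.symm hBC hAC)
      (hcol _ _ _ (by simp) (by simp) (by simp) hAC hAD hCD)
      (hcol _ _ _ (by simp) (by simp) (by simp) hAC hAE hCE)
      (hcol _ _ _ (by simp) (by simp) (by simp) hAC hAF hCF) hDEF)
    (eval_add_ne_zero hKh hK0 hC hA hB hD hE hF
      (hcol _ _ _ (by simp) (by simp) (by simp) hAC.symm hBC.symm hAB)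
      (hcol _ _ _ (by simp) (by simp) (by simp) hAB hAD hBD)
      (hcol _ _ _ (by simp) (by simp) (by simp) hAB hAE hBE)
      (hcol _ _ _ (by simp) (by simp) (by simp) hAB hAF hBF) hDEF)
  obtain ⟨a, ha⟩ := T.exists_isParam (T.mul_eq_sq _ hA)
  obtain ⟨b, hb⟩ := T.exists_isParam (T.mul_eq_sq _ hB)
  obtain ⟨c, hc⟩ := T.exists_isParam (T.mul_eq_sq _ hC)
  obtain ⟨d, hd⟩ := T.exists_isParam (T.mul_eq_sq _ hD)
  obtain ⟨e, he⟩ := T.exists_isParam (T.mul_eq_sq _ hE)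
  obtain ⟨f, hf⟩ := T.exists_isParam (T.mul_eq_sq _ hF)
  obtain ⟨kAB, hkAB, eAB⟩ := ConicCoordinates.exists_chord_eq hlAB ha hb hc hAB hAC hBC
  obtain ⟨kBF, hkBF, eBF⟩ := ConicCoordinates.exists_chord_eq hlBF hb hf ha hBF hAB.symm hAF.symm
  obtain ⟨kDF, hkDF, eDF⟩ := ConicCoordinates.exists_chord_eq hlDF hd hf ha hDF hAD.symm hAF.symm
  obtain ⟨kCD, hkCD, eCD⟩ := ConicCoordinates.exists_chord_eq hlCD hc hd ha hCD hAC.symm hAD.symm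
  obtain ⟨kCE, hkCE, eCE⟩ := ConicCoordinates.exists_chord_eq hlCE hc he ha hCE hAC.symm hAE.symm
  obtain ⟨kAE, hkAE, eAE⟩ := ConicCoordinates.exists_chord_eq hlAE ha he hb hAE hAB hBE.symm
  obtain ⟨kEF, hkEF, eEF⟩ := ConicCoordinates.exists_chord_eq hlEF he hf ha hEF hAE.symm hAF.symm
  obtain ⟨kBD, hkBD, eBD⟩ := ConicCoordinates.exists_chord_eq hlBD hb hd ha hBD hAB.symm hAD.symm
  obtain ⟨kAC, hkAC, eAC⟩ := ConicCoordinates.exists_chord_eq hlAC ha hc hb hAC hAB hBC.symm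
  have hoff₁ : ∀ P : ProjPlane, A ≠ P → B ≠ P → C ≠ P → D ≠ P → E ≠ P → F ≠ P →
      eval P.rep (lAB * lDF * lCE) = 0 → T.X P.rep * T.Z P.rep - T.Y P.rep ^ 2 ≠ 0 := by
    intro P nA nB nC nD nE nF h
    rw [map_mul, map_mul, mul_eq_zero, mul_eq_zero] at h
    rcases h with (h | h) | h
    · exact ConicCoordinates.mul_ne_sq_of_mem_line ha hb eAB nA nB h
    · exact ConicCoordinates.mul_ne_sq_of_mem_line hd hf eDF nD nF h
    · exact ConicCoordinates.mul_ne_sq_of_mem_line hc he eCE nC nE h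
  have hoff₂ : ∀ P : ProjPlane, A ≠ P → B ≠ P → C ≠ P → D ≠ P → E ≠ P → F ≠ P →
      eval P.rep (lAE * lBF * lCD) = 0 → T.X P.rep * T.Z P.rep - T.Y P.rep ^ 2 ≠ 0 := by
    intro P nA nB nC nD nE nF h
    rw [map_mul, map_mul, mul_eq_zero, mul_eq_zero] at h
    rcases h with (h | h) | h
    · exact ConicCoordinates.mul_ne_sq_of_mem_line ha he eAE nA nE h
    · exact ConicCoordinates.mul_ne_sq_of_mem_line hb hf eBF nB nF h
    · exact ConicCoordinates.mul_ne_sq_of_mem_line hc hd eCD nC nD h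
  have h₁ := T.chord_mul_sub a b f d c e
  have h₂ := T.chord_mul_sub a e f b d c
  have h₃ := T.chord_mul_sub a b d f e c
  simp only [T.chord_comm f d, T.chord_comm d c, T.chord_comm e a, T.chord_comm f b,
    T.chord_comm c a, T.chord_comm e c, T.chord_comm f e,
    eAB, eBF, eDF, eCD, eCE, eAE, eEF, eBD, eAC] at h₁ h₂ h₃
  obtain ⟨P, hP₁, hP₂⟩ := exists_common_zero
    (T.chordQuotient a b f d c e - T.chordQuotient b f d c e a)
    (T.chordQuotient a e f b d c - T.chordQuotient e f b d c a)
  refine ⟨P,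
    hp₁.eval_eq_zero (mul_ne_zero (mul_ne_zero hkAB hkDF) hkCE) (k₂ := kBF * kCD * kAE)
      (q := fun v => T.X v * T.Z v - T.Y v ^ 2) (fun v => ?_) hoff₁ hP₁,
    hp₂.eval_eq_zero (mul_ne_zero (mul_ne_zero hkAE hkBF) hkCD) (k₂ := kEF * kBD * kAC)
      (q := fun v => T.X v * T.Z v - T.Y v ^ 2) (fun v => ?_) hoff₂ hP₂,
    hp₃.eval_eq_zero (mul_ne_zero (mul_ne_zero hkAB hkDF) hkCE) (k₂ := kBD * kEF * kAC)
      (q := fun v => T.X v * T.Z v - T.Y v ^ 2)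
      (g := T.chordQuotient a b d f e c - T.chordQuotient b d f e c a) (fun v => ?_) hoff₁ ?_⟩
  · rw [LinearMap.sub_apply, ← h₁ v]
    simp only [map_mul]
    ring
  · rw [LinearMap.sub_apply, ← h₂ v]
    simp only [map_mul]
    ring
  · rw [LinearMap.sub_apply, ← h₃ v]
    simp only [map_mul]
    ring
  · simp only [LinearMap.sub_apply, ConicCoordinates.chordQuotient, LinearMap.add_apply,
      LinearMap.smul_apply, smul_eq_mul] at hP₁ hP₂ ⊢
    linear_combination hP₁ + hP₂
end
end

section
/- Let A, B, C, D, E, F be six distinct points of ℙ²(ℂ) on an irreducible conic 𝒞. Let 𝒞₁ be a conic through A, B, C, D; 𝒞₂ a conic through A, B, E, F; and 𝒞₃ a conic through C, D, E, F, such that each pair among 𝒞₁, 𝒞₂, 𝒞₃ has defining polynomials with no common nonconstant factor and common zero set consisting of exactly four distinct points. Let p₃ be the line through the two points of 𝒞₁ ∩ 𝒞₂ distinct from A and B, p₂ the line through the two points of 𝒞₁ ∩ 𝒞₃ distinct from C and D, and p₁ the line through the two points of 𝒞₂ ∩ 𝒞₃ distinct from E and F (each pair of residual points assumed distinct, spanning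 a unique line). Then there is a point of ℙ²(ℂ) lying on all three lines p₁, p₂, p₃. -/
open MvPolynomial

noncomputable section

open Matrix

/-- The linear form with coefficient vector `u`. -/
def linForm (u : Fin 3 → ℂ) : Poly3 := ∑ i, C (u i) * X i

@[simp]
theorem eval_linForm (u v : Fin 3 → ℂ) : eval v (linForm u) = u ⬝ᵥ v := by
  simp [linForm, dotProduct]

theorem linForm_sub (u v : Fin 3 → ℂ) : linForm (u - v) = linForm u - linForm v := by
  simp [linForm, sub_mul, Finset.sum_sub_distrib]

theorem linForm_smul (c : ℂ) (u : Fin 3 → ℂ) : linForm (c • u) = C c * linForm u := by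
  simp [linForm, Finset.mul_sum, mul_assoc]

theorem linForm_zero : linForm 0 = 0 := by
  simp [linForm]

theorem not_isUnit_linForm (u : Fin 3 → ℂ) : ¬ IsUnit (linForm u) := fun h => by
  simpa only [eval_linForm, dotProduct_zero, not_isUnit_zero] using h.map (eval (0 : Fin 3 → ℂ))

theorem MvPolynomial.IsHomogeneous.exists_eq_sum_X_mul {n : ℕ} {F : Poly3}
    (hF : F.IsHomogeneous (n + 1)) :
    ∃ G : Fin 3 → Poly3, (∀ i, (G i).IsHomogeneous n) ∧ F = ∑ i, X i * G i := by
  rw [F.as_sum]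
  refine Finset.sum_induction _ (fun F : Poly3 =>
    ∃ G : Fin 3 → Poly3, (∀ i, (G i).IsHomogeneous n) ∧ F = ∑ i, X i * G i) ?_ ?_ ?_
  · rintro _ _ ⟨G, hG, rfl⟩ ⟨H, hH, rfl⟩
    exact ⟨fun i => G i + H i, fun i => (hG i).add (hH i), by
      simp [mul_add, Finset.sum_add_distrib]⟩
  · exact ⟨0, fun i => isHomogeneous_zero _ _ _, by simp⟩
  · intro d hd
    have hdeg : d.degree = n + 1 := by
      rw [Finsupp.degree_eq_weight_one]
      exact hF (mem_support_iff.mp hd)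
    obtain ⟨i, hi⟩ : ∃ i, d i ≠ 0 := by
      by_contra! h
      have : d = 0 := Finsupp.ext h
      simp [this] at hdeg
    obtain ⟨e, rfl⟩ : ∃ e, d = Finsupp.single i 1 + e :=
      ⟨d - Finsupp.single i 1, (add_tsub_cancel_of_le
        (Finsupp.single_le_iff.mpr (Nat.one_le_iff_ne_zero.mpr hi))).symm⟩
    refine ⟨Pi.single i (monomial e (coeff (Finsupp.single i 1 + e) F)), fun j => ?_, ?_⟩
    · rcases eq_or_ne j i with rfl | hj
      · rw [Pi.single_eq_same]
        refine isHomogeneous_monomial _ ?_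
        simp only [map_add, Finsupp.degree_single] at hdeg
        lia
      · rw [Pi.single_eq_of_ne hj]
        exact isHomogeneous_zero _ _ _
    · rw [Finset.sum_eq_single i (fun j _ hj => by rw [Pi.single_eq_of_ne hj, mul_zero])
        (by simp), Pi.single_eq_same, X, monomial_mul, one_mul]

theorem MvPolynomial.IsHomogeneous.exists_eq_linForm {L : Poly3} (hL : L.IsHomogeneous 1) :
    ∃ u, L = linForm u := by
  obtain ⟨G, hG, rfl⟩ := hL.exists_eq_sum_X_mul
  refine ⟨fun i => coeff 0 (G i), Finset.sum_congr rfl fun i _ => ?_⟩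
  conv_lhs => rw [mul_comm, totalDegree_eq_zero_iff_eq_C.mp
    (Nat.le_zero.mp (hG i).totalDegree_le)]

theorem MvPolynomial.IsHomogeneous.exists_eval_eq_sum {F : Poly3} (hF : F.IsHomogeneous 2) :
    ∃ S : Fin 3 → Fin 3 → ℂ, ∀ v, eval v F = ∑ i, v i * ∑ j, S i j * v j := by
  obtain ⟨G, hG, rfl⟩ := hF.exists_eq_sum_X_mul
  choose S hS using fun i => (hG i).exists_eq_linForm
  exact ⟨S, fun v => by simp [hS, dotProduct]⟩

theorem exists_eq_smul_cross {u x y : Fin 3 → ℂ} (hxy : x ⨯₃ y ≠ 0)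
    (hx : u ⬝ᵥ x = 0) (hy : u ⬝ᵥ y = 0) : ∃ c : ℂ, u = c • (x ⨯₃ y) := by
  obtain ⟨i, hi⟩ := Function.ne_iff.mp hxy
  refine ⟨u i / (x ⨯₃ y) i, funext fun j => ?_⟩
  rw [Pi.smul_apply, smul_eq_mul, div_mul_eq_mul_div, eq_div_iff hi]
  simp only [vec3_dotProduct] at hx hy
  fin_cases i <;> fin_cases j <;> simp [cross_apply] <;> grind

theorem exists_eq_linForm_mul {F : Poly3} (hF : F.IsHomogeneous 2) {a b p : Fin 3 → ℂ}
    (hab : a ⨯₃ b ≠ 0) (hap : a ⨯₃ p ≠ 0) (hbp : b ⨯₃ p ≠ 0) (hl : (a ⨯₃ b) ⬝ᵥ p = 0)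
    (ha : eval a F = 0) (hb : eval b F = 0) (hp : eval p F = 0) :
    ∃ w, F = linForm (a ⨯₃ b) * linForm w := by
  obtain ⟨S, hS⟩ := hF.exists_eval_eq_sum
  obtain ⟨i, hi⟩ := Function.ne_iff.mp hab
  set e : Fin 3 → ℂ := Pi.single i ((a ⨯₃ b) i)⁻¹ with he_def
  have he : (a ⨯₃ b) ⬝ᵥ e = 1 := by
    rw [he_def, dotProduct_single]; exact mul_inv_cancel₀ hi
  have hdecomp : ∀ v, v = ((a ⨯₃ b) ⬝ᵥ v) • e + ((b ⨯₃ e) ⬝ᵥ v) • a + ((e ⨯₃ a) ⬝ᵥ v) • b := by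
    intro v
    have : ((a ⨯₃ b) ⬝ᵥ e) • v =
        ((a ⨯₃ b) ⬝ᵥ v) • e + ((b ⨯₃ e) ⬝ᵥ v) • a + ((e ⨯₃ a) ⬝ᵥ v) • b := by
      ext j
      simp only [vec3_dotProduct, cross_apply, Pi.add_apply, Pi.smul_apply, smul_eq_mul]
      fin_cases j <;> simp <;> ring
    rwa [he, one_smul] at this
  set β : (Fin 3 → ℂ) → (Fin 3 → ℂ) → ℂ := fun v w =>
    ∑ i, v i * ∑ j, S i j * w j + ∑ i, w i * ∑ j, S i j * v j with hβ
  have hexp : ∀ x y z : ℂ, eval (x • e + y • a + z • b) F =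
      x * (x * eval e F + y * β e a + z * β e b) + y * z * β a b := by
    intro x y z
    have : eval (x • e + y • a + z • b) F =
      x * (x * eval e F + y * β e a + z * β e b) + y * z * β a b
        + y ^ 2 * eval a F + z ^ 2 * eval b F := by
      simp only [hS, hβ, Fin.sum_univ_three, Pi.add_apply, Pi.smul_apply, smul_eq_mul]
      ring
    simpa [ha, hb] using this
  have hβab : β a b = 0 := by
    have h := hdecomp p
    rw [hl] at h
    have h1 := hexp 0 ((b ⨯₃ e) ⬝ᵥ p) ((e ⨯₃ a) ⬝ᵥ p)
    rw [← h, hp] at h1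
    have hy : (b ⨯₃ e) ⬝ᵥ p ≠ 0 := fun h0 => hbp (by
      rw [h, h0]; simp)
    have hz : (e ⨯₃ a) ⬝ᵥ p ≠ 0 := fun h0 => hap (by
      rw [h, h0]; simp)
    simpa [hy, hz] using h1.symm
  refine ⟨eval e F • (a ⨯₃ b) + β e a • (b ⨯₃ e) + β e b • (e ⨯₃ a), ?_⟩
  refine MvPolynomial.funext fun v => ?_
  conv_lhs => rw [hdecomp v]
  rw [hexp, hβab]
  simp only [map_mul, eval_linForm, add_dotProduct, smul_dotProduct, smul_eq_mul]
  ring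

theorem cross_dotProduct_ne_zero_of_irreducible {K : Poly3} (hKh : K.IsHomogeneous 2)
    (hK : Irreducible K) {a b p : Fin 3 → ℂ}
    (hab : a ⨯₃ b ≠ 0) (hap : a ⨯₃ p ≠ 0) (hbp : b ⨯₃ p ≠ 0)
    (ha : eval a K = 0) (hb : eval b K = 0) (hp : eval p K = 0) :
    (a ⨯₃ b) ⬝ᵥ p ≠ 0 := fun hl => by
  obtain ⟨w, hw⟩ := exists_eq_linForm_mul hKh hab hap hbp hl ha hb hp
  exact (hK.isUnit_or_isUnit hw).elim (not_isUnit_linForm _) (not_isUnit_linForm _)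

/-- The conics through four points of an irreducible conic `K` form the pencil spanned by `K`
and a pair of lines through these points. -/
theorem exists_mem_pencil {K F : Poly3} (hKh : K.IsHomogeneous 2) (hK : Irreducible K)
    (hF : F.IsHomogeneous 2) {a b c d : Fin 3 → ℂ}
    (hab : a ⨯₃ b ≠ 0) (hac : a ⨯₃ c ≠ 0) (had : a ⨯₃ d ≠ 0)
    (hbc : b ⨯₃ c ≠ 0) (hbd : b ⨯₃ d ≠ 0) (hcd : c ⨯₃ d ≠ 0)
    (hKa : eval a K = 0) (hKb : eval b K = 0) (hKc : eval c K = 0) (hKd : eval d K = 0)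
    (hFa : eval a F = 0) (hFb : eval b F = 0) (hFc : eval c F = 0) (hFd : eval d F = 0) :
    ∃ s t : ℂ, F = C s * K + C t * (linForm (a ⨯₃ b) * linForm (c ⨯₃ d)) := by
  have haP : a ⨯₃ (a + b) ≠ 0 := by simpa using hab
  have hbP : b ⨯₃ (a + b) ≠ 0 := by
    rw [map_add, cross_self, add_zero, ← cross_anticomm]
    exact neg_ne_zero.mpr hab
  have hl : (a ⨯₃ b) ⬝ᵥ (a + b) = 0 := by
    rw [dotProduct_comm, add_dotProduct, dot_self_cross, dot_cross_self, add_zero]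
  have hP : eval (a + b) K ≠ 0 := fun h =>
    cross_dotProduct_ne_zero_of_irreducible hKh hK hab haP hbP hKa hKb h hl
  obtain ⟨w, hw⟩ := exists_eq_linForm_mul (F := F - C (eval (a + b) F / eval (a + b) K) * K)
    (hF.sub (hKh.C_mul _)) hab haP hbP hl
    (by simp [hFa, hKa]) (by simp [hFb, hKb]) (by simp [hP])
  have hwc : w ⬝ᵥ c = 0 := by
    have := congrArg (eval c) hw
    simpa [hFc, hKc, cross_dotProduct_ne_zero_of_irreducible hKh hK hab hac hbc hKa hKb hKc]
      using this
  have hwd : w ⬝ᵥ d = 0 := by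
    have := congrArg (eval d) hw
    simpa [hFd, hKd, cross_dotProduct_ne_zero_of_irreducible hKh hK hab had hbd hKa hKb hKd]
      using this
  obtain ⟨t, rfl⟩ := exists_eq_smul_cross hcd hwc hwd
  rw [linForm_smul] at hw
  exact ⟨eval (a + b) F / eval (a + b) K, t, by linear_combination hw⟩

theorem not_isRelPrime_of_C_mul_eq {F G : Poly3} (hG : G ≠ 0)
    (hGh : G.IsHomogeneous 2) {s t : ℂ} (hst : s ≠ 0 ∨ t ≠ 0) (h : C t * F = C s * G) :
    ¬ IsRelPrime F G := fun hrel => by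
  have ht : t ≠ 0 := by
    rintro rfl
    simp_all
  have hdvd : G ∣ F := ⟨C (s / t), mul_left_cancel₀ (C_ne_zero.mpr ht) (by
    rw [h, mul_left_comm, ← C_mul, mul_div_cancel₀ _ ht, mul_comm])⟩
  have hu := (hrel hdvd dvd_rfl).map (eval (0 : Fin 3 → ℂ))
  obtain ⟨S, hS⟩ := hGh.exists_eval_eq_sum
  rw [hS] at hu
  simp at hu

/-- The line through the residual intersection points of two conics through two common points
of `K`. -/
theorem exists_residual_line_eq {K F G : Poly3} (hKh : K.IsHomogeneous 2) (hK : Irreducible K)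
    (hG : G ≠ 0) (hGh : G.IsHomogeneous 2) (hrel : IsRelPrime F G)
    {a b x y m n u : Fin 3 → ℂ} {s t s' t' : ℂ}
    (hFeq : F = C s * K + C t * (linForm (a ⨯₃ b) * linForm m))
    (hGeq : G = C s' * K + C t' * (linForm (a ⨯₃ b) * linForm n))
    (hab : a ⨯₃ b ≠ 0) (hax : a ⨯₃ x ≠ 0) (hay : a ⨯₃ y ≠ 0)
    (hbx : b ⨯₃ x ≠ 0) (hby : b ⨯₃ y ≠ 0) (hxy : x ⨯₃ y ≠ 0)
    (hKa : eval a K = 0) (hKb : eval b K = 0)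
    (hFx : eval x F = 0) (hFy : eval y F = 0) (hGx : eval x G = 0) (hGy : eval y G = 0)
    (hux : u ⬝ᵥ x = 0) (huy : u ⬝ᵥ y = 0) :
    ∃ k : ℂ, u = k • ((s' * t) • m - (s * t') • n) := by
  have hs : s ≠ 0 ∨ s' ≠ 0 := by
    by_contra! h
    refine not_isUnit_linForm (a ⨯₃ b) (hrel ?_ ?_)
    · exact ⟨C t * linForm m, by rw [hFeq, h.1, C_0]; ring⟩
    · exact ⟨C t' * linForm n, by rw [hGeq, h.2, C_0]; ring⟩
  set q := (s' * t) • m - (s * t') • n with hq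
  have hlin : C s' * F - C s * G = linForm (a ⨯₃ b) * linForm q := by
    rw [hFeq, hGeq, hq, linForm_sub, linForm_smul, linForm_smul]
    simp only [C_mul]
    ring
  have hq0 : q ≠ 0 := fun h => by
    rw [h, linForm_zero, mul_zero, sub_eq_zero] at hlin
    exact not_isRelPrime_of_C_mul_eq hG hGh hs hlin hrel
  have hvanish : ∀ v, a ⨯₃ v ≠ 0 → b ⨯₃ v ≠ 0 → eval v F = 0 → eval v G = 0 → q ⬝ᵥ v = 0 := by
    intro v hav hbv hFv hGv
    have h := congrArg (eval v) hlin
    simp only [map_sub, map_mul, hFv, hGv, eval_linForm, mul_zero, sub_zero] at h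
    refine (mul_eq_zero.mp h.symm).resolve_left fun hl => ?_
    refine cross_dotProduct_ne_zero_of_irreducible hKh hK hab hav hbv hKa hKb ?_ hl
    rw [hFeq] at hFv
    rw [hGeq] at hGv
    simp only [map_add, map_mul, eval_C, eval_linForm, hl, zero_mul, mul_zero, add_zero,
      mul_eq_zero] at hFv hGv
    tauto
  obtain ⟨k, hk⟩ := exists_eq_smul_cross hxy hux huy
  obtain ⟨j, hj⟩ := exists_eq_smul_cross hxy (hvanish x hax hbx hFx hGx) (hvanish y hay hby hFy hGy)
  have hj0 : j ≠ 0 := by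
    rintro rfl
    exact hq0 (by rw [hj, zero_smul])
  exact ⟨k / j, by rw [hj, smul_smul, div_mul_cancel₀ _ hj0, hk]⟩

theorem exists_common_zero_s8 (l m n : Fin 3 → ℂ) (s₁ s₂ s₃ t₁ t₂ t₃ : ℂ) :
    ∃ z ≠ 0, ((s₂ * t₁) • m - (s₁ * t₂) • n) ⬝ᵥ z = 0 ∧
      ((s₃ * t₁) • l - (s₁ * t₃) • n) ⬝ᵥ z = 0 ∧
      ((s₃ * t₂) • l - (s₂ * t₃) • m) ⬝ᵥ z = 0 := by
  obtain ⟨z, hz, h⟩ := exists_mulVec_eq_zero_iff.mpr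
    (show (of ![(s₂ * t₁) • m - (s₁ * t₂) • n, (s₃ * t₁) • l - (s₁ * t₃) • n,
      (s₃ * t₂) • l - (s₂ * t₃) • m]).det = 0 by
        simp [det_fin_three]
        ring)
  exact ⟨z, hz, congrFun h 0, congrFun h 1, congrFun h 2⟩

theorem cross_rep_ne_zero {p q : ProjPlane} (h : p ≠ q) : p.rep ⨯₃ q.rep ≠ 0 := by
  rw [crossProduct_ne_zero_iff_linearIndependent]
  have := Projectivization.independent_iff.mp ((Projectivization.independent_pair_iff_ne p q).mpr h)
  have hrep : Projectivization.rep ∘ ![p, q] = ![p.rep, q.rep] := by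
    ext i
    fin_cases i <;> rfl
  rwa [hrep] at this

theorem vanishesAt_mk_linForm {u z : Fin 3 → ℂ} (hz : z ≠ 0) (h : u ⬝ᵥ z = 0) :
    VanishesAt (linForm u) (Projectivization.mk ℂ z hz) := by
  obtain ⟨c, hc⟩ := Projectivization.exists_smul_eq_mk_rep ℂ z hz
  rw [VanishesAt, ← hc, eval_linForm, dotProduct_smul, h, smul_zero]

/-- Three conics `𝒞₁` (through `A,B,C,D`), `𝒞₂` (through `A,B,E,F`) and `𝒞₃`
(through `C,D,E,F`) inscribed configurations of six points on an irreducible conic: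
the three lines through the pairwise residual intersection points pass through a
common point. -/
theorem three_conics_pencil_of_lines (A B C D E F : ProjPlane)
    (hdist : ([A, B, C, D, E, F] : List ProjPlane).Pairwise (· ≠ ·))
    (K : Poly3) (hKh : K.IsHomogeneous 2) (hKirr : Irreducible K)
    (honK : ∀ p ∈ [A, B, C, D, E, F], VanishesAt K p)
    (C₁ C₂ C₃ : Poly3)
    (h1 : C₁ ≠ 0) (h2 : C₂ ≠ 0) (h3 : C₃ ≠ 0)
    (h1h : C₁.IsHomogeneous 2) (h2h : C₂.IsHomogeneous 2) (h3h : C₃.IsHomogeneous 2)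
    (hon1 : ∀ p ∈ [A, B, C, D], VanishesAt C₁ p)
    (hon2 : ∀ p ∈ [A, B, E, F], VanishesAt C₂ p)
    (hon3 : ∀ p ∈ [C, D, E, F], VanishesAt C₃ p)
    (h12 : IsRelPrime C₁ C₂) (h13 : IsRelPrime C₁ C₃) (h23 : IsRelPrime C₂ C₃)
    (X₁ Y₁ X₂ Y₂ X₃ Y₃ : ProjPlane)
    (hd12 : ([A, B, X₃, Y₃] : List ProjPlane).Pairwise (· ≠ ·))
    (hz12 : zeroSet C₁ ∩ zeroSet C₂ = {A, B, X₃, Y₃})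
    (hd13 : ([C, D, X₂, Y₂] : List ProjPlane).Pairwise (· ≠ ·))
    (hz13 : zeroSet C₁ ∩ zeroSet C₃ = {C, D, X₂, Y₂})
    (hd23 : ([E, F, X₁, Y₁] : List ProjPlane).Pairwise (· ≠ ·))
    (hz23 : zeroSet C₂ ∩ zeroSet C₃ = {E, F, X₁, Y₁})
    (p₁ p₂ p₃ : Poly3)
    (hp₁ : IsLineThrough p₁ X₁ Y₁)
    (hp₂ : IsLineThrough p₂ X₂ Y₂)
    (hp₃ : IsLineThrough p₃ X₃ Y₃) :
    ∃ Z : ProjPlane, VanishesAt p₁ Z ∧ VanishesAt p₂ Z ∧ VanishesAt p₃ Z := by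
  simp only [List.pairwise_cons, List.mem_cons, List.not_mem_nil, or_false, forall_eq_or_imp,
    forall_eq] at hdist honK hon1 hon2 hon3 hd12 hd13 hd23
  obtain ⟨⟨hAB, hAC, hAD, hAE, hAF⟩, ⟨hBC, hBD, hBE, hBF⟩, ⟨hCD, hCE, hCF⟩, ⟨hDE, hDF⟩, hEF, -⟩ :=
    hdist
  obtain ⟨hKA, hKB, hKC, hKD, hKE, hKF⟩ := honK
  obtain ⟨hA1, hB1, hC1, hD1⟩ := hon1
  obtain ⟨hA2, hB2, hE2, hF2⟩ := hon2
  obtain ⟨hC3, hD3, hE3, hF3⟩ := hon3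
  obtain ⟨⟨-, hAX, hAY⟩, ⟨hBX, hBY⟩, hXY3, -⟩ := hd12
  obtain ⟨⟨-, hCX, hCY⟩, ⟨hDX, hDY⟩, hXY2, -⟩ := hd13
  obtain ⟨⟨-, hEX, hEY⟩, ⟨hFX, hFY⟩, hXY1, -⟩ := hd23
  obtain ⟨hX31, hX32⟩ : X₃ ∈ zeroSet C₁ ∩ zeroSet C₂ := by simp [hz12]
  obtain ⟨hY31, hY32⟩ : Y₃ ∈ zeroSet C₁ ∩ zeroSet C₂ := by simp [hz12]
  obtain ⟨hX21, hX23⟩ : X₂ ∈ zeroSet C₁ ∩ zeroSet C₃ := by simp [hz13]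
  obtain ⟨hY21, hY23⟩ : Y₂ ∈ zeroSet C₁ ∩ zeroSet C₃ := by simp [hz13]
  obtain ⟨hX12, hX13⟩ : X₁ ∈ zeroSet C₂ ∩ zeroSet C₃ := by simp [hz23]
  obtain ⟨hY12, hY13⟩ : Y₁ ∈ zeroSet C₂ ∩ zeroSet C₃ := by simp [hz23]
  obtain ⟨-, hp1h, hpX1, hpY1⟩ := hp₁
  obtain ⟨-, hp2h, hpX2, hpY2⟩ := hp₂
  obtain ⟨-, hp3h, hpX3, hpY3⟩ := hp₃
  obtain ⟨u₁, rfl⟩ := hp1h.exists_eq_linForm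
  obtain ⟨u₂, rfl⟩ := hp2h.exists_eq_linForm
  obtain ⟨u₃, rfl⟩ := hp3h.exists_eq_linForm
  rw [VanishesAt, eval_linForm] at hpX1 hpX2 hpX3 hpY1 hpY2 hpY3
  obtain ⟨s₁, t₁, hC₁⟩ := exists_mem_pencil hKh hKirr h1h (cross_rep_ne_zero hAB)
    (cross_rep_ne_zero hAC) (cross_rep_ne_zero hAD) (cross_rep_ne_zero hBC)
    (cross_rep_ne_zero hBD) (cross_rep_ne_zero hCD) hKA hKB hKC hKD hA1 hB1 hC1 hD1
  obtain ⟨s₂, t₂, hC₂⟩ := exists_mem_pencil hKh hKirr h2h (cross_rep_ne_zero hAB)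
    (cross_rep_ne_zero hAE) (cross_rep_ne_zero hAF) (cross_rep_ne_zero hBE)
    (cross_rep_ne_zero hBF) (cross_rep_ne_zero hEF) hKA hKB hKE hKF hA2 hB2 hE2 hF2
  obtain ⟨s₃, t₃, hC₃⟩ := exists_mem_pencil hKh hKirr h3h (cross_rep_ne_zero hCD)
    (cross_rep_ne_zero hCE) (cross_rep_ne_zero hCF) (cross_rep_ne_zero hDE)
    (cross_rep_ne_zero hDF) (cross_rep_ne_zero hEF) hKC hKD hKE hKF hC3 hD3 hE3 hF3
  obtain ⟨k₃, hk₃⟩ := exists_residual_line_eq hKh hKirr h2 h2h h12 hC₁ hC₂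
    (cross_rep_ne_zero hAB) (cross_rep_ne_zero hAX) (cross_rep_ne_zero hAY)
    (cross_rep_ne_zero hBX) (cross_rep_ne_zero hBY) (cross_rep_ne_zero hXY3)
    hKA hKB hX31 hY31 hX32 hY32 hpX3 hpY3
  obtain ⟨k₂, hk₂⟩ := exists_residual_line_eq hKh hKirr h3 h3h h13
    (hC₁.trans (by rw [mul_comm (linForm _)])) hC₃
    (cross_rep_ne_zero hCD) (cross_rep_ne_zero hCX) (cross_rep_ne_zero hCY)
    (cross_rep_ne_zero hDX) (cross_rep_ne_zero hDY) (cross_rep_ne_zero hXY2)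
    hKC hKD hX21 hY21 hX23 hY23 hpX2 hpY2
  obtain ⟨k₁, hk₁⟩ := exists_residual_line_eq hKh hKirr h3 h3h h23
    (hC₂.trans (by rw [mul_comm (linForm _)])) (hC₃.trans (by rw [mul_comm (linForm _)]))
    (cross_rep_ne_zero hEF) (cross_rep_ne_zero hEX) (cross_rep_ne_zero hEY)
    (cross_rep_ne_zero hFX) (cross_rep_ne_zero hFY) (cross_rep_ne_zero hXY1)
    hKE hKF hX12 hY12 hX13 hY13 hpX1 hpY1
  obtain ⟨z, hz, hz₃, hz₂, hz₁⟩ := exists_common_zero_s8 (A.rep ⨯₃ B.rep) (C.rep ⨯₃ D.rep)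
    (E.rep ⨯₃ F.rep) s₁ s₂ s₃ t₁ t₂ t₃
  refine ⟨Projectivization.mk ℂ z hz, vanishesAt_mk_linForm hz ?_, vanishesAt_mk_linForm hz ?_,
    vanishesAt_mk_linForm hz ?_⟩
  · rw [hk₁, smul_dotProduct, hz₁, smul_zero]
  · rw [hk₂, smul_dotProduct, hz₂, smul_zero]
  · rw [hk₃, smul_dotProduct, hz₃, smul_zero]
end
end
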